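/- If S and T are sequences ℕ → ℝ that both satisfy the product rule for triangular numbers, with S(0) = T(0) = 0, S(1) = T(1) = 1, and S(2) = T(2), then S(n) = T(n) for all n ≥ 0. -/

import Mathlib

def ProductRule (T : ℕ → ℝ) : Prop :=
  ∀ m n : ℕ, 1 ≤ m → 1 ≤ n → T (m * n) = T m * T n + T (m - 1) * T (n - 1)

theorem ProductRule.two_mul {T : ℕ → ℝ} (hT : ProductRule T) (h1 : T 1 = 1) {n : ℕ}
    (hn : 1 ≤ n) : T (2 * n) = T 2 * T n + T (n - 1) := by
  simpa [h1] using hT 2 n (by norm_num) hn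

theorem ProductRule.two_mul_sub_one {T : ℕ → ℝ} (hT : ProductRule T) (h1 : T 1 = 1) {n : ℕ}
    (hn : 1 ≤ n) : T (2 * n - 1) = T n + (T 3 - T 2) * T (n - 1) := by
  have h4 := hT 2 2 (by norm_num) (by norm_num)
  have h4n := hT 4 n (by norm_num) hn
  have h22n := hT.two_mul h1 (n := 2 * n) (by omega)
  have h2n := hT.two_mul h1 hn
  norm_num [h1] at h4 h4n
  rw [← mul_assoc] at h22n
  norm_num at h22n
  rw [h4n, h4, h2n] at h22n
  linear_combination -h22n

theorem ProductRule.three_eq {T : ℕ → ℝ} (hT : ProductRule T) (h1 : T 1 = 1) :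
    T 3 = 2 * T 2 := by
  have h4 := hT.two_mul h1 (n := 2) (by norm_num)
  have h5 := hT.two_mul_sub_one h1 (n := 3) (by norm_num)
  have h6 := hT.two_mul h1 (n := 3) (by norm_num)
  have h7 := hT.two_mul_sub_one h1 (n := 4) (by norm_num)
  have h8 := hT.two_mul h1 (n := 4) (by norm_num)
  have h9 := hT.two_mul_sub_one h1 (n := 5) (by norm_num)
  have h10 := hT.two_mul h1 (n := 5) (by norm_num)
  have h11 := hT.two_mul_sub_one h1 (n := 6) (by norm_num)
  have h15 := hT.two_mul_sub_one h1 (n := 8) (by norm_num)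
  have h21 := hT.two_mul_sub_one h1 (n := 11) (by norm_num)
  have h3x3 := hT 3 3 (by norm_num) (by norm_num)
  have h3x5 := hT 3 5 (by norm_num) (by norm_num)
  have h3x7 := hT 3 7 (by norm_num) (by norm_num)
  norm_num at h4 h5 h6 h7 h8 h9 h10 h11 h15 h21 h3x3 h3x5 h3x7
  obtain ⟨c, hc⟩ : ∃ c, T 3 = T 2 + c := ⟨T 3 - T 2, by ring⟩
  generalize T 2 = a at *
  simp only [h21, h15, h11, h10, h9, h8, h7, h6, h5, h4, hc, h1] at h3x3 h3x5 h3x7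
  have e1 : c * (c - 2) = a ^ 2 * (c - 2) - a * (c - 1) := by linear_combination -h3x3
  have e2 : a ^ 2 + a * (2 * c - 1) - (c ^ 3 - c ^ 2 + 2 * c) = 0 := by
    linear_combination -h3x5
  have l1 : a * (1 - 4 * c + 2 * c ^ 2) = c * (c - 2) * (c ^ 2 - c + 1) := by
    linear_combination (c - 2) * e2 + e1
  have l2 : a * (-2 + 5 * c - 3 * c ^ 2 - 4 * c ^ 3) =
      4 * c - 9 * c ^ 2 + 4 * c ^ 3 - 2 * c ^ 4 - c ^ 5 := by
    linear_combination h3x7 - (-2 * a - 2 + 3 * c + c ^ 2) * e2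
  have hp : (c * (c - 2) * (c ^ 2 - c + 1)) ^ 2
      + c * (c - 2) * (c ^ 2 - c + 1) * (1 - 4 * c + 2 * c ^ 2) * (2 * c - 1)
      - (c ^ 3 - c ^ 2 + 2 * c) * (1 - 4 * c + 2 * c ^ 2) ^ 2 = 0 := by
    linear_combination (1 - 4 * c + 2 * c ^ 2) ^ 2 * e2
      - (a * (1 - 4 * c + 2 * c ^ 2) + c * (c - 2) * (c ^ 2 - c + 1)
        + (1 - 4 * c + 2 * c ^ 2) * (2 * c - 1)) * l1
  have hq : c * (c - 2) * (c ^ 2 - c + 1) * (-2 + 5 * c - 3 * c ^ 2 - 4 * c ^ 3)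
      - (4 * c - 9 * c ^ 2 + 4 * c ^ 3 - 2 * c ^ 4 - c ^ 5) * (1 - 4 * c + 2 * c ^ 2) = 0 := by
    linear_combination (1 - 4 * c + 2 * c ^ 2) * l2
      - (-2 + 5 * c - 3 * c ^ 2 - 4 * c ^ 3) * l1
  have hg : c ^ 2 * ((c - 1) * (c - 3)) = 0 := by
    linear_combination (-1 + c - 2 * c ^ 2) * hp + (1 - c + 2 * c ^ 2 - c ^ 3) * hq
  rcases mul_eq_zero.mp hg with h | h
  · obtain rfl : c = 0 := pow_eq_zero_iff (by norm_num) |>.mp h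
    linarith
  · rcases mul_eq_zero.mp h with h | h
    · obtain rfl : c = 1 := by linarith
      linarith
    · obtain rfl : c = 3 := by linarith
      linarith

theorem stmt_14 (S T : ℕ → ℝ) (hS : ProductRule S) (hT : ProductRule T)
    (hS0 : S 0 = 0) (hT0 : T 0 = 0) (hS1 : S 1 = 1) (hT1 : T 1 = 1)
    (h2 : S 2 = T 2) :
    ∀ n : ℕ, S n = T n := by
  have h3 : S 3 = T 3 := by rw [hS.three_eq hS1, hT.three_eq hT1, h2]
  intro n
  induction n using Nat.strong_induction_on with
  | _ n ih =>
    rcases Nat.lt_or_ge n 2 with hn | hn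
    · interval_cases n
      · rw [hS0, hT0]
      · rw [hS1, hT1]
    · rcases Nat.even_or_odd' n with ⟨k, rfl | rfl⟩
      · rw [hS.two_mul hS1 (by omega), hT.two_mul hT1 (by omega), h2, ih k (by omega),
          ih (k - 1) (by omega)]
      · have hk : 2 * k + 1 = 2 * (k + 1) - 1 := by omega
        rw [hk, hS.two_mul_sub_one hS1 (by omega), hT.two_mul_sub_one hT1 (by omega), h2, h3,
          ih (k + 1) (by omega), ih (k + 1 - 1) (by omega)]
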